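/- arXiv:1601.01411 — 2 statements merged into one kernel-verified Lean document; each statement's English description precedes it below -/
import Mathlib

section
/- Let φ : [-1,1] → ℝ be continuous. Then the following are equivalent: (i) for every n ≥ 1 and every real positive semidefinite n×n matrix K all of whose entries lie in [-1,1], the matrix K' defined entrywise by K'_{ij} = φ(K_{ij}) is positive semidefinite; (ii) there exists a sequence of nonnegative real numbers (α_i)_{i≥0} with Σ_{i=0}^∞ α_i < ∞ such that φ(t) = Σ_{i=0}^∞ α_i t^i for all t ∈ [-1,1]. -/
open Matrix

open Set Filter Topology unitInterval

/-- The coordinates `±1` of the vertex of the discrete cube encoded by a finite set. -/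
noncomputable def cubeSign {ι : Type*} [DecidableEq ι] (A : Finset ι) (i : ι) : ℝ :=
  if i ∈ A then -1 else 1

section Cube

variable {ι : Type*} [DecidableEq ι]

lemma cubeSign_symmDiff (A B : Finset ι) (i : ι) :
    cubeSign (symmDiff A B) i = cubeSign A i * cubeSign B i := by
  by_cases hA : i ∈ A <;> by_cases hB : i ∈ B <;> simp [cubeSign, Finset.mem_symmDiff, hA, hB]

variable [Fintype ι]

lemma sum_cubeSign (A : Finset ι) :
    ∑ i, cubeSign A i = (Fintype.card ι : ℝ) - 2 * A.card := by
  have h (i : ι) : cubeSign A i = 1 - 2 * (if i ∈ A then 1 else 0) := by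
    by_cases hA : i ∈ A <;> norm_num [cubeSign, hA]
  simp only [h, Finset.sum_sub_distrib, ← Finset.mul_sum]
  simp

lemma prod_one_add_mul_cubeSign_div_two (A : Finset ι) (s : ℝ) :
    ∏ i, ((1 + (1 - 2 * s) * cubeSign A i) / 2) =
      s ^ A.card * (1 - s) ^ (Fintype.card ι - A.card) := by
  have h (i : ι) : (1 + (1 - 2 * s) * cubeSign A i) / 2 = if i ∈ A then s else 1 - s := by
    by_cases hA : i ∈ A
    · simp only [cubeSign, hA, if_true]; ring
    · simp only [cubeSign, hA, if_false]; ring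
  simp only [h, Finset.prod_ite, Finset.prod_const]
  congr 2
  · simp
  · rw [← Finset.card_compl]
    congr 1
    ext
    simp

/-- Expansion of a Bernstein polynomial in powers of `1 - 2 * s` through Walsh coefficients. -/
lemma sum_bernstein_eq_sum_walsh (g : ℕ → ℝ) (s : ℝ) :
    ∑ k ∈ Finset.range (Fintype.card ι + 1),
        ((Fintype.card ι).choose k * s ^ k * (1 - s) ^ (Fintype.card ι - k)) * g k =
      ∑ S : Finset ι, ((1 / 2) ^ Fintype.card ι *
        ∑ A : Finset ι, g A.card * ∏ i ∈ S, cubeSign A i) * (1 - 2 * s) ^ S.card := by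
  have h1 := Finset.sum_powerset_apply_card
    (fun k => (s ^ k * (1 - s) ^ (Fintype.card ι - k)) * g k) (x := (Finset.univ : Finset ι))
  rw [Finset.powerset_univ, Finset.card_univ] at h1
  have h2 : ∑ k ∈ Finset.range (Fintype.card ι + 1),
        ((Fintype.card ι).choose k * s ^ k * (1 - s) ^ (Fintype.card ι - k)) * g k =
      ∑ A : Finset ι, (s ^ A.card * (1 - s) ^ (Fintype.card ι - A.card)) * g A.card := by
    rw [h1]
    refine Finset.sum_congr rfl fun k _ => ?_
    rw [nsmul_eq_mul]
    ring
  have h3 (A : Finset ι) : s ^ A.card * (1 - s) ^ (Fintype.card ι - A.card) =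
      (1 / 2) ^ Fintype.card ι * ∑ S : Finset ι, (1 - 2 * s) ^ S.card * ∏ i ∈ S, cubeSign A i := by
    rw [← prod_one_add_mul_cubeSign_div_two, Finset.prod_div_distrib, Finset.prod_one_add,
      Finset.powerset_univ]
    simp only [Finset.prod_mul_distrib, Finset.prod_const, Finset.card_univ]
    rw [one_div, inv_pow, div_eq_inv_mul]
  rw [h2]
  simp only [h3, Finset.mul_sum, Finset.sum_mul]
  rw [Finset.sum_comm]
  refine Finset.sum_congr rfl fun S _ => Finset.sum_congr rfl fun A _ => ?_
  ring

lemma posSemidef_cube_correlation :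
    (Matrix.of fun A B : Finset ι =>
      (∑ i, cubeSign (symmDiff A B) i) / (Fintype.card ι : ℝ)).PosSemidef := by
  have h := (posSemidef_self_mul_conjTranspose
    (Matrix.of fun (A : Finset ι) (i : ι) => cubeSign A i)).smul
      (show (0 : ℝ) ≤ (Fintype.card ι : ℝ)⁻¹ by positivity)
  convert! h using 1
  ext A B
  simp [Matrix.mul_apply, cubeSign_symmDiff, div_eq_inv_mul]

lemma cube_correlation_mem_Icc (A : Finset ι) :
    (∑ i, cubeSign A i) / (Fintype.card ι : ℝ) ∈ Icc (-1 : ℝ) 1 := by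
  have hA : (A.card : ℝ) ≤ Fintype.card ι := by exact_mod_cast Finset.card_le_univ A
  have h0 : (0 : ℝ) ≤ A.card := by positivity
  rw [sum_cubeSign]
  rcases (Nat.cast_nonneg (α := ℝ) (Fintype.card ι)).eq_or_lt with h | h
  · simp [← h]
  · rw [mem_Icc, le_div_iff₀ h, div_le_iff₀ h]
    constructor <;> linarith

/-- A function on the discrete cube that is positive definite has nonnegative Walsh
coefficients. -/
lemma walsh_coeff_nonneg (f : Finset ι → ℝ)
    (hf : (Matrix.of fun A B : Finset ι => f (symmDiff A B)).PosSemidef) (S : Finset ι) :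
    0 ≤ ∑ A : Finset ι, f A * ∏ i ∈ S, cubeSign A i := by
  have h := hf.dotProduct_mulVec_nonneg fun A => ∏ i ∈ S, cubeSign A i
  have h2 (A : Finset ι) : ∑ B : Finset ι, (∏ i ∈ S, cubeSign A i) *
      (f (symmDiff A B) * ∏ i ∈ S, cubeSign B i) =
        ∑ C : Finset ι, f C * ∏ i ∈ S, cubeSign C i := by
    refine Fintype.sum_equiv ((symmDiff_right_involutive A).toPerm _) _ _ fun B => ?_
    change _ = f (symmDiff A B) * ∏ i ∈ S, cubeSign (symmDiff A B) i
    simp only [cubeSign_symmDiff, Finset.prod_mul_distrib]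
    ring
  simp only [dotProduct, mulVec, Matrix.of_apply, Pi.star_apply, star_trivial, Finset.mul_sum,
    h2, Finset.sum_const] at h
  rw [nsmul_eq_mul] at h
  exact nonneg_of_mul_nonneg_right h (by simp)

end Cube

/-- The entrywise action of `φ` preserves positive semidefiniteness of matrices, of all sizes, with
entries in `[-1,1]`. -/
def PreservesPosSemidef (φ : ℝ → ℝ) : Prop :=
  ∀ n : ℕ, 1 ≤ n → ∀ K : Matrix (Fin n) (Fin n) ℝ, K.PosSemidef →
    (∀ i j, K i j ∈ Icc (-1 : ℝ) 1) → (Matrix.of fun i j => φ (K i j)).PosSemidef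

lemma PreservesPosSemidef.map_fintype {φ : ℝ → ℝ} (h : PreservesPosSemidef φ) {κ : Type*}
    [Fintype κ] [Nonempty κ] {K : Matrix κ κ ℝ} (hK : K.PosSemidef)
    (hmem : ∀ i j, K i j ∈ Icc (-1 : ℝ) 1) : (Matrix.of fun i j => φ (K i j)).PosSemidef := by
  have e := Fintype.equivFin κ
  have := (h _ Fintype.card_pos (K.submatrix e.symm e.symm) (hK.submatrix _)
    fun i j => hmem _ _).submatrix e
  convert! this using 1
  ext i j
  simp

/-- The Bernstein polynomials of `s ↦ φ (1 - 2 * s)` are polynomials in `1 - 2 * s` with nonnegative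
coefficients. -/
lemma PreservesPosSemidef.exists_hasSum_bernstein {φ : ℝ → ℝ} (h : PreservesPosSemidef φ)
    {d : ℕ} (hd : d ≠ 0) (f : C(I, ℝ)) (hf : ∀ s : I, f s = φ (1 - 2 * s)) :
    ∃ a : ℕ → ℝ, (∀ k, 0 ≤ a k) ∧
      ∀ s : I, HasSum (fun k => a k * (1 - 2 * (s : ℝ)) ^ k) (bernsteinApproximation d f s) := by
  set c : Finset (Fin d) → ℝ := fun S => (1 / 2) ^ d *
    ∑ A : Finset (Fin d), φ (1 - 2 * (A.card / d)) * ∏ i ∈ S, cubeSign A i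
  have hd' : (d : ℝ) ≠ 0 := by exact_mod_cast hd
  have hc0 (S) : 0 ≤ c S := by
    refine mul_nonneg (by positivity) (walsh_coeff_nonneg (fun A => φ (1 - 2 * (A.card / d))) ?_ S)
    have := h.map_fintype (posSemidef_cube_correlation (ι := Fin d))
      fun A B => cube_correlation_mem_Icc _
    convert! this using 4 with A B
    rw [Matrix.of_apply, sum_cubeSign, Fintype.card_fin]
    field_simp
  refine ⟨fun k => ∑ S : Finset (Fin d) with S.card = k, c S,
    fun k => Finset.sum_nonneg fun S _ => hc0 S, fun s => ?_⟩
  have key : bernsteinApproximation d f s = ∑ k ∈ Finset.range (d + 1),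
      (∑ S : Finset (Fin d) with S.card = k, c S) * (1 - 2 * (s : ℝ)) ^ k := by
    have h1 := sum_bernstein_eq_sum_walsh (ι := Fin d) (fun k => φ (1 - 2 * (k / d))) s
    rw [Fintype.card_fin] at h1
    rw [bernsteinApproximation.apply]
    simp only [bernstein_apply, hf, smul_eq_mul, bernstein.z]
    rw [← Finset.sum_range fun k : ℕ => (d.choose k * (s : ℝ) ^ k * (1 - s) ^ (d - k)) *
      φ (1 - 2 * (k / d)), h1]
    rw [← Finset.sum_fiberwise_of_maps_to (s := Finset.univ) (t := Finset.range (d + 1))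
      (g := Finset.card)]
    · refine Finset.sum_congr rfl fun k _ => ?_
      rw [Finset.sum_mul]
      refine Finset.sum_congr rfl fun S hS => ?_
      rw [(Finset.mem_filter.1 hS).2]
    · intro S _
      have := Finset.card_le_univ S
      rw [Fintype.card_fin] at this
      exact Finset.mem_range.2 (Nat.lt_succ_of_le this)
  rw [key]
  refine hasSum_sum_of_ne_finset_zero fun k hk => ?_
  beta_reduce
  rw [Finset.filter_false_of_mem, Finset.sum_empty, zero_mul]
  intro S _ hS
  have := Finset.card_le_univ S
  rw [Fintype.card_fin] at this
  exact hk (Finset.mem_range.2 (by omega))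

lemma abs_mul_pow_le_of_mem_Icc {a t : ℝ} (ha : 0 ≤ a) (ht : t ∈ Icc (-1 : ℝ) 1) (k : ℕ) :
    ‖a * t ^ k‖ ≤ a := by
  rw [norm_mul, norm_pow, Real.norm_of_nonneg ha, Real.norm_eq_abs]
  exact mul_le_of_le_one_right ha (pow_le_one₀ (abs_nonneg t) (abs_le.2 ht))

/-- Pointwise limits on `[-1,1]` of power series with nonnegative coefficients, if continuous, are
again power series with nonnegative coefficients. -/
lemma exists_summable_of_tendsto_hasSum {φ : ℝ → ℝ} (hφ : ContinuousOn φ (Icc (-1) 1))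
    {a : ℕ → ℕ → ℝ} {p : ℕ → ℝ → ℝ} (ha : ∀ n k, 0 ≤ a n k)
    (hp : ∀ n, ∀ t ∈ Icc (-1 : ℝ) 1, HasSum (fun k => a n k * t ^ k) (p n t))
    (hlim : ∀ t ∈ Icc (-1 : ℝ) 1, Tendsto (fun n => p n t) atTop (𝓝 (φ t))) :
    ∃ α : ℕ → ℝ, (∀ i, 0 ≤ α i) ∧ Summable α ∧
      ∀ t ∈ Icc (-1 : ℝ) 1, φ t = ∑' i, α i * t ^ i := by
  have one_mem : (1 : ℝ) ∈ Icc (-1 : ℝ) 1 := by norm_num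
  obtain ⟨C, hC⟩ := (hlim 1 one_mem).bddAbove_range
  have hC (n : ℕ) : p n 1 ≤ C := hC ⟨n, rfl⟩
  have hsum (n : ℕ) : HasSum (a n) (p n 1) := by simpa using hp n 1 one_mem
  have haC (n k : ℕ) : a n k ≤ C := (le_hasSum (hsum n) k fun j _ => ha n j).trans (hC n)
  obtain ⟨α, hα, u, hu, hlimα⟩ :=
    (isCompact_univ_pi fun _ : ℕ => isCompact_Icc (a := (0 : ℝ)) (b := C)).tendsto_subseq
      (x := a) fun n k _ => ⟨ha n k, haC n k⟩
  have hα0 (k : ℕ) : 0 ≤ α k := (hα k (mem_univ k)).1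
  have hlimα (k : ℕ) : Tendsto (fun n => a (u n) k) atTop (𝓝 (α k)) :=
    tendsto_pi_nhds.1 hlimα k
  have hαs : Summable α := by
    refine summable_of_sum_range_le (c := C) hα0 fun N => ?_
    refine le_of_tendsto (tendsto_finsetSum _ fun k _ => hlimα k) (Eventually.of_forall fun n => ?_)
    exact (sum_le_hasSum _ (fun k _ => ha _ k) (hsum (u n))).trans (hC _)
  refine ⟨α, hα0, hαs, ?_⟩
  have hopen : EqOn φ (fun t => ∑' i, α i * t ^ i) (Ioo (-1) 1) := by
    intro t ht
    have ht1 : |t| < 1 := abs_lt.2 ht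
    refine tendsto_nhds_unique ((hlim t (Ioo_subset_Icc_self ht)).comp hu.tendsto_atTop) ?_
    have : (fun n => p n t) ∘ u = fun n => ∑' k, a (u n) k * t ^ k :=
      funext fun n => (hp _ t (Ioo_subset_Icc_self ht)).tsum_eq.symm
    rw [this]
    refine tendsto_tsum_of_dominated_convergence (bound := fun k => C * |t| ^ k)
      ((summable_geometric_of_lt_one (abs_nonneg t) ht1).mul_left C)
      (fun k => (hlimα k).mul_const _) (Eventually.of_forall fun n k => ?_)
    rw [norm_mul, norm_pow, Real.norm_of_nonneg (ha _ _), Real.norm_eq_abs]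
    exact mul_le_mul_of_nonneg_right (haC _ _) (by positivity)
  have hcont : ContinuousOn (fun t : ℝ => ∑' i, α i * t ^ i) (Icc (-1) 1) :=
    continuousOn_tsum (fun k => by fun_prop) hαs
      fun k t ht => abs_mul_pow_le_of_mem_Icc (hα0 k) ht k
  refine fun t ht => hopen.of_subset_closure hφ hcont Ioo_subset_Icc_self ?_ ht
  rw [closure_Ioo (by norm_num)]

lemma PreservesPosSemidef.exists_summable {φ : ℝ → ℝ} (h : PreservesPosSemidef φ)
    (hφ : ContinuousOn φ (Icc (-1) 1)) :
    ∃ α : ℕ → ℝ, (∀ i, 0 ≤ α i) ∧ Summable α ∧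
      ∀ t ∈ Icc (-1 : ℝ) 1, φ t = ∑' i, α i * t ^ i := by
  have hmaps (s : I) : 1 - 2 * (s : ℝ) ∈ Icc (-1 : ℝ) 1 := by
    have := s.2.1
    have := s.2.2
    constructor <;> linarith
  let f : C(I, ℝ) := ⟨fun s => φ (1 - 2 * s), hφ.comp_continuous (by fun_prop) hmaps⟩
  choose a ha hsum using fun n : ℕ => h.exists_hasSum_bernstein n.succ_ne_zero f fun _ => rfl
  have hmem {t : ℝ} (ht : t ∈ Icc (-1 : ℝ) 1) : (1 - t) / 2 ∈ I := by
    have := ht.1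
    have := ht.2
    constructor <;> linarith
  have hproj {t : ℝ} (ht : t ∈ Icc (-1 : ℝ) 1) :
      1 - 2 * (projIcc (0 : ℝ) 1 zero_le_one ((1 - t) / 2) : ℝ) = t := by
    rw [projIcc_of_mem _ (hmem ht)]
    ring
  refine exists_summable_of_tendsto_hasSum hφ (a := a)
    (p := fun n t => bernsteinApproximation (n + 1) f (projIcc 0 1 zero_le_one ((1 - t) / 2)))
    ha (fun n t ht => ?_) fun t ht => ?_
  · simpa only [hproj ht] using hsum n (projIcc 0 1 zero_le_one ((1 - t) / 2))
  · have h1 : φ t = f (projIcc 0 1 zero_le_one ((1 - t) / 2)) := by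
      change φ t = φ _
      rw [hproj ht]
    rw [h1]
    exact (((continuous_eval_const (F := C(I, ℝ)) _).tendsto _).comp
      (bernsteinApproximation_uniform f)).comp (tendsto_add_atTop_nat 1)

lemma Matrix.PosSemidef.entrywise_pow {κ : Type*} [Fintype κ] {K : Matrix κ κ ℝ}
    (hK : K.PosSemidef) (m : ℕ) : (Matrix.of fun i j => K i j ^ m).PosSemidef := by
  induction m with
  | zero =>
    convert! posSemidef_vecMulVec_self_star (fun _ : κ => (1 : ℝ)) using 1
    ext i j
    simp [vecMulVec_apply]
  | succ m ih =>
    convert! ih.hadamard hK using 1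

lemma Matrix.PosSemidef.entrywise_tsum {κ : Type*} [Fintype κ] {K : Matrix κ κ ℝ}
    (hK : K.PosSemidef) (hmem : ∀ i j, K i j ∈ Icc (-1 : ℝ) 1) {α : ℕ → ℝ} (hα : ∀ i, 0 ≤ α i)
    (hs : Summable α) : (Matrix.of fun i j => ∑' m, α m * K i j ^ m).PosSemidef := by
  have hsum (i j : κ) : HasSum (fun m => α m * K i j ^ m) (∑' m, α m * K i j ^ m) :=
    (Summable.of_norm_bounded hs fun m => abs_mul_pow_le_of_mem_Icc (hα m) (hmem i j) m).hasSum
  refine .of_dotProduct_mulVec_nonneg ?_ fun x => ?_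
  · ext i j
    have := hK.isHermitian.apply i j
    simp_all
  · have h : HasSum (fun m => α m * (star x ⬝ᵥ (Matrix.of fun i j => K i j ^ m) *ᵥ x))
        (star x ⬝ᵥ (Matrix.of fun i j => ∑' m, α m * K i j ^ m) *ᵥ x) := by
      simp only [dotProduct, mulVec, Matrix.of_apply, Finset.mul_sum]
      refine hasSum_sum fun i _ => hasSum_sum fun j _ => ?_
      convert! ((hsum i j).mul_right (x j)).mul_left (star x i) using 2
      ring
    exact h.nonneg fun m => mul_nonneg (hα m) ((hK.entrywise_pow m).dotProduct_mulVec_nonneg x)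

/-- Schoenberg's theorem: a continuous function `φ : [-1,1] → ℝ` maps every real positive
semidefinite matrix (of any size, with entries in `[-1,1]`) to a positive semidefinite matrix
under entrywise application if and only if `φ(t) = Σ_{i≥0} α_i t^i` with all `α_i ≥ 0` and
`Σ_i α_i < ∞`. -/
theorem schoenberg_entrywise_posSemidef_iff
    (φ : ℝ → ℝ) (hφ : ContinuousOn φ (Set.Icc (-1) 1)) :
    (∀ n : ℕ, 1 ≤ n → ∀ K : Matrix (Fin n) (Fin n) ℝ, K.PosSemidef →
        (∀ i j, K i j ∈ Set.Icc (-1 : ℝ) 1) →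
        (Matrix.of fun i j => φ (K i j)).PosSemidef) ↔
    (∃ α : ℕ → ℝ, (∀ i, 0 ≤ α i) ∧ Summable α ∧
        ∀ t ∈ Set.Icc (-1 : ℝ) 1, φ t = ∑' i, α i * t ^ i) := by
  refine ⟨fun h => PreservesPosSemidef.exists_summable h hφ, ?_⟩
  rintro ⟨α, hα, hs, hsum⟩ n - K hK hmem
  simpa only [hsum _ (hmem _ _)] using hK.entrywise_tsum hmem hα hs
end

section
/- Fix an integer d ≥ 3, set γ = (d-2)/2, and let G_k^γ be the Gegenbauer polynomials defined by G_0^γ(t) = 1, G_1^γ(t) = 2γt, and G_{i+1}^γ(t) = (2(γ+i)/(i+1)) t G_i^γ(t) − ((2γ+i−1)/(i+1)) G_{i−1}^γ(t). Then for every k ≥ 0 and every finite set of points x₁, …, x_m on the unit sphere S^{d-1} ⊂ ℝ^d, the m×m matrix with entries G_k^γ(⟨x_i, x_j⟩) is positive semidefinite. Consequently, for any nonnegative reals α_0, …, α_N, the matrix with entries Σ_{k=0}^N α_k G_k^γ(⟨x_i, x_j⟩) is positive semidefinite. -/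
open Matrix
open scoped RealInnerProductSpace

/-- The Gegenbauer (ultraspherical) polynomials `G_i^γ`, defined by the three-term recurrence
`G_0^γ(t) = 1`, `G_1^γ(t) = 2γt`,
`G_{i+1}^γ(t) = (2(γ+i)/(i+1)) t G_i^γ(t) − ((2γ+i−1)/(i+1)) G_{i−1}^γ(t)`. -/
noncomputable def gegenbauer (γ : ℝ) : ℕ → ℝ → ℝ
  | 0, _ => 1
  | 1, t => 2 * γ * t
  | (n + 2), t =>
      (2 * (γ + ((n : ℝ) + 1)) / (((n : ℝ) + 1) + 1)) * t * gegenbauer γ (n + 1) t -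
      ((2 * γ + ((n : ℝ) + 1) - 1) / (((n : ℝ) + 1) + 1)) * gegenbauer γ n t


open MvPolynomial

section Fischer

theorem C_two {σ : Type*} : (C 2 : MvPolynomial σ ℝ) = 2 := map_ofNat C 2

variable {σ : Type*} [Fintype σ]

/-- The Fischer inner product on real polynomials, for which monomials are orthogonal and
multiplication by `X i` is adjoint to `pderiv i`. -/
noncomputable def fischer : MvPolynomial σ ℝ →ₗ[ℝ] MvPolynomial σ ℝ →ₗ[ℝ] ℝ :=
  (basisMonomials σ ℝ).constr ℝ fun m => (∏ i, ((m i).factorial : ℝ)) • lcoeff ℝ m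

theorem fischer_monomial (m : σ →₀ ℕ) (a : ℝ) (q : MvPolynomial σ ℝ) :
    fischer (monomial m a) q = a * ((∏ i, ((m i).factorial : ℝ)) * coeff m q) := by
  have h : (monomial m a : MvPolynomial σ ℝ) = a • basisMonomials σ ℝ m := by
    simp [smul_monomial]
  rw [h, map_smul, fischer, Module.Basis.constr_basis]
  simp

theorem fischer_self_nonneg (p : MvPolynomial σ ℝ) : 0 ≤ fischer p p := by
  conv_rhs => enter [1, 2]; rw [p.as_sum]
  rw [map_sum, LinearMap.sum_apply]
  refine Finset.sum_nonneg fun m _ => ?_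
  rw [fischer_monomial]
  have : 0 ≤ (∏ i, ((m i).factorial : ℝ)) := by positivity
  nlinarith [mul_nonneg this (mul_self_nonneg (coeff m p))]

theorem fischer_X_mul (i : σ) (p q : MvPolynomial σ ℝ) :
    fischer (X i * p) q = fischer p (pderiv i q) := by
  classical
  induction p using MvPolynomial.induction_on' with
  | add p q hp hq => simp [mul_add, hp, hq]
  | monomial m a =>
    rw [X, monomial_mul, fischer_monomial, fischer_monomial, coeff_pderiv, add_comm _ m, one_mul]
    have h : (∏ j, (((m + Finsupp.single i 1 : σ →₀ ℕ) j).factorial : ℝ))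
        = (m i + 1) * ∏ j, ((m j).factorial : ℝ) := by
      rw [← Finset.mul_prod_erase _ _ (Finset.mem_univ i),
        ← Finset.mul_prod_erase Finset.univ (fun j => ((m j).factorial : ℝ)) (Finset.mem_univ i),
        ← mul_assoc]
      congr 1
      · simp [Nat.factorial_succ]
      · refine Finset.prod_congr rfl fun j hj => ?_
        simp [(Finset.ne_of_mem_erase hj).symm]
    rw [h]
    ring

theorem fischer_C_mul (a : ℝ) (p q : MvPolynomial σ ℝ) :
    fischer (C a * p) q = a * fischer p q := by
  rw [C_mul', map_smul, LinearMap.smul_apply, smul_eq_mul]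

/-- The derivative in the direction `y`. -/
noncomputable def dirDeriv (y : σ → ℝ) : Derivation ℝ (MvPolynomial σ ℝ) (MvPolynomial σ ℝ) :=
  ∑ i, (C (y i) : MvPolynomial σ ℝ) • pderiv i

/-- The linear form `x ↦ ∑ i, y i * x i`. -/
noncomputable def linForm (y : σ → ℝ) : MvPolynomial σ ℝ := ∑ i, C (y i) * X i

variable (σ) in
/-- The quadratic form `x ↦ ∑ i, x i ^ 2`. -/
noncomputable def normSqPoly : MvPolynomial σ ℝ := ∑ i, X i ^ 2

/-- The Laplacian of a polynomial. -/
noncomputable def laplacian (p : MvPolynomial σ ℝ) : MvPolynomial σ ℝ :=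
  ∑ i, pderiv i (pderiv i p)

theorem dirDeriv_apply (y : σ → ℝ) (p : MvPolynomial σ ℝ) :
    dirDeriv y p = ∑ i, C (y i) * pderiv i p := by
  have h := congrFun (map_sum (Derivation.coeFnAddMonoidHom (R := ℝ) (A := MvPolynomial σ ℝ)
    (M := MvPolynomial σ ℝ)) (fun i => (C (y i) : MvPolynomial σ ℝ) • pderiv i) Finset.univ) p
  rw [Finset.sum_apply] at h
  exact h

theorem pderiv_linForm (y : σ → ℝ) (i : σ) : pderiv i (linForm y) = C (y i) := by
  classical
  simp [linForm, pderiv_X, Pi.single_apply]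

theorem pderiv_normSqPoly (i : σ) : pderiv i (normSqPoly σ) = 2 * X i := by
  classical
  simp [normSqPoly, pderiv_X, Pi.single_apply]

theorem fischer_linForm_mul (y : σ → ℝ) (p q : MvPolynomial σ ℝ) :
    fischer (linForm y * p) q = fischer p (dirDeriv y q) := by
  simp only [linForm, dirDeriv_apply, Finset.sum_mul, map_sum, LinearMap.sum_apply]
  refine Finset.sum_congr rfl fun i _ => ?_
  rw [mul_assoc, fischer_C_mul, fischer_X_mul, C_mul', map_smul, smul_eq_mul]

theorem fischer_normSqPoly_mul (p q : MvPolynomial σ ℝ) :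
    fischer (normSqPoly σ * p) q = fischer p (laplacian q) := by
  simp only [normSqPoly, laplacian, Finset.sum_mul, map_sum, LinearMap.sum_apply, pow_two,
    mul_assoc, fischer_X_mul]


theorem laplacian_sub (p q : MvPolynomial σ ℝ) :
    laplacian (p - q) = laplacian p - laplacian q := by
  simp [laplacian]

theorem laplacian_C_mul (a : ℝ) (p : MvPolynomial σ ℝ) :
    laplacian (C a * p) = C a * laplacian p := by
  simp [laplacian, Finset.mul_sum]

theorem laplacian_linForm_mul (y : σ → ℝ) (p : MvPolynomial σ ℝ) :
    laplacian (linForm y * p) = linForm y * laplacian p + 2 * dirDeriv y p := by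
  simp only [laplacian, dirDeriv_apply, Finset.mul_sum, ← Finset.sum_add_distrib]
  refine Finset.sum_congr rfl fun i _ => ?_
  simp only [pderiv_mul, map_add, pderiv_linForm, pderiv_C]
  ring

theorem laplacian_normSqPoly_mul {p : MvPolynomial σ ℝ} {n : ℕ} (hp : p.IsHomogeneous n) :
    laplacian (normSqPoly σ * p) =
      normSqPoly σ * laplacian p + (4 * n + 2 * Fintype.card σ) * p := by
  have h2 (i : σ) : pderiv i (2 : MvPolynomial σ ℝ) = 0 := pderiv_C (R := ℝ) (a := 2)
  have key (i : σ) : pderiv i (pderiv i (normSqPoly σ * p)) =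
      normSqPoly σ * pderiv i (pderiv i p) + 4 * (X i * pderiv i p) + 2 * p := by
    simp only [pderiv_mul, map_add, pderiv_normSqPoly, pderiv_X_self, h2]
    ring
  simp only [laplacian, key, Finset.sum_add_distrib, ← Finset.mul_sum, hp.sum_X_mul_pderiv]
  simp
  ring

theorem dirDeriv_linForm (y : σ → ℝ) : dirDeriv y (linForm y) = C (∑ i, y i ^ 2) := by
  simp [dirDeriv_apply, pderiv_linForm, pow_two]

theorem dirDeriv_normSqPoly (y : σ → ℝ) : dirDeriv y (normSqPoly σ) = 2 * linForm y := by
  simp only [dirDeriv_apply, pderiv_normSqPoly, linForm, Finset.mul_sum]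
  exact Finset.sum_congr rfl fun i _ => by ring

theorem isHomogeneous_linForm (y : σ → ℝ) : (linForm y).IsHomogeneous 1 :=
  IsHomogeneous.sum _ _ _ fun _ _ => isHomogeneous_C_mul_X _ _

theorem isHomogeneous_normSqPoly : (normSqPoly σ).IsHomogeneous 2 :=
  IsHomogeneous.sum _ _ _ fun _ _ => isHomogeneous_X_pow _ _

theorem isHomogeneous_dirDeriv (y : σ → ℝ) {q : MvPolynomial σ ℝ} {k : ℕ}
    (hq : q.IsHomogeneous (k + 1)) : (dirDeriv y q).IsHomogeneous k := by
  rw [dirDeriv_apply]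
  exact IsHomogeneous.sum _ _ _ fun i _ => (hq.pderiv (i := i)).C_mul _

theorem fischer_linForm_pow (y : σ → ℝ) {k : ℕ} {q : MvPolynomial σ ℝ}
    (hq : q.IsHomogeneous k) : fischer (linForm y ^ k) q = k.factorial * eval y q := by
  induction k generalizing q with
  | zero =>
    rw [← totalDegree_zero_iff_isHomogeneous, totalDegree_eq_zero_iff_eq_C] at hq
    rw [hq, pow_zero, ← C_1, C_apply, fischer_monomial]
    simp
  | succ k ih =>
    have h := congrArg (eval y) hq.sum_X_mul_pderiv
    have h' : eval y (dirDeriv y q) = (k + 1) * eval y q := by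
      simpa [dirDeriv_apply] using h
    rw [pow_succ', fischer_linForm_mul, ih (isHomogeneous_dirDeriv y hq), h', Nat.factorial_succ]
    push_cast
    ring

/-- The zonal harmonic polynomial of degree `n` with pole `y`: the homogenization of
`x ↦ gegenbauer γ n ⟪y, x⟫`. -/
noncomputable def zonal (γ : ℝ) (y : σ → ℝ) : ℕ → MvPolynomial σ ℝ
  | 0 => 1
  | 1 => C (2 * γ) * linForm y
  | (n + 2) =>
      C (2 * (γ + ((n : ℝ) + 1)) / (((n : ℝ) + 1) + 1)) * (linForm y * zonal γ y (n + 1)) -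
      C ((2 * γ + ((n : ℝ) + 1) - 1) / (((n : ℝ) + 1) + 1)) * (normSqPoly σ * zonal γ y n)

theorem isHomogeneous_zonal (γ : ℝ) (y : σ → ℝ) (n : ℕ) : (zonal γ y n).IsHomogeneous n := by
  induction n using Nat.twoStepInduction with
  | zero => exact isHomogeneous_one _ _
  | one => exact (isHomogeneous_linForm y).C_mul _
  | more n h0 h1 =>
    refine IsHomogeneous.sub (.C_mul ?_ _) (.C_mul ?_ _)
    · simpa [add_comm, add_left_comm] using (isHomogeneous_linForm y).mul h1
    · simpa [add_comm] using isHomogeneous_normSqPoly.mul h0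

theorem eval_zonal (γ : ℝ) (x y : σ → ℝ) (hx : ∑ i, x i ^ 2 = 1) (n : ℕ) :
    eval x (zonal γ y n) = gegenbauer γ n (∑ i, y i * x i) := by
  have hl : eval x (linForm y) = ∑ i, y i * x i := by simp [linForm]
  have hr : eval x (normSqPoly σ) = 1 := by simp [normSqPoly, hx]
  induction n using Nat.twoStepInduction with
  | zero => simp [zonal, gegenbauer]
  | one => simp [zonal, gegenbauer, hl]
  | more n h0 h1 => simp [zonal, gegenbauer, hl, hr, h0, h1, mul_assoc]

theorem add_two_mul_zonal (γ : ℝ) (y : σ → ℝ) (n : ℕ) :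
    ((n : MvPolynomial σ ℝ) + 2) * zonal γ y (n + 2) =
      2 * (C (σ := σ) γ + n + 1) * (linForm y * zonal γ y (n + 1)) -
        (2 * C (σ := σ) γ + (n : MvPolynomial σ ℝ)) * (normSqPoly σ * zonal γ y n) := by
  have hn : (n : ℝ) + 1 + 1 ≠ 0 := by positivity
  have h1 : ((n : MvPolynomial σ ℝ) + 2) * C (2 * (γ + ((n : ℝ) + 1)) / (((n : ℝ) + 1) + 1)) =
      2 * (C (σ := σ) γ + (n : MvPolynomial σ ℝ) + 1) := by
    rw [show (n : MvPolynomial σ ℝ) + 2 = C ((n : ℝ) + 1 + 1) by simp; ring, ← C_mul,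
      mul_div_cancel₀ _ hn]
    simp [C_two]
    ring
  have h2 : ((n : MvPolynomial σ ℝ) + 2) * C ((2 * γ + ((n : ℝ) + 1) - 1) / (((n : ℝ) + 1) + 1)) =
      2 * C (σ := σ) γ + (n : MvPolynomial σ ℝ) := by
    rw [show (n : MvPolynomial σ ℝ) + 2 = C ((n : ℝ) + 1 + 1) by simp; ring, ← C_mul,
      mul_div_cancel₀ _ hn]
    simp [C_two]
    ring
  simp only [zonal]
  linear_combination (linForm y * zonal γ y (n + 1)) * h1 - (normSqPoly σ * zonal γ y n) * h2

theorem dirDeriv_zonal (γ : ℝ) (y : σ → ℝ) (hy : ∑ i, y i ^ 2 = 1) (n : ℕ) :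
    dirDeriv y (zonal γ y (n + 1)) = (2 * C (σ := σ) γ + n) * zonal γ y n ∧
      ((n : MvPolynomial σ ℝ) + 1) * zonal γ y (n + 1) =
        2 * (C (σ := σ) γ + n) * (linForm y * zonal γ y n) - normSqPoly σ * dirDeriv y (zonal γ y n) := by
  have hl : dirDeriv y (linForm y) = 1 := by rw [dirDeriv_linForm, hy, C_1]
  induction n with
  | zero =>
    have h1 : dirDeriv y (zonal γ y 1) = C (2 * γ) := by
      rw [zonal, C_mul', Derivation.map_smul, hl, smul_eq_C_mul, mul_one]
    constructor
    · simp [h1, C_two]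
      simp [zonal]
    · simp [zonal, C_two]
  | succ n ih =>
    obtain ⟨ih1, ih2⟩ := ih
    have h := add_two_mul_zonal γ y n
    have hn : (n : MvPolynomial σ ℝ) + 2 ≠ 0 := by exact_mod_cast (n + 1).succ_ne_zero
    refine ⟨mul_left_cancel₀ hn ?_, ?_⟩
    · have hD := congrArg (dirDeriv y) h
      have hc : ((n : MvPolynomial σ ℝ) + 2) = C ((n : ℝ) + 2) := by simp [C_two]
      have ha : 2 * (C (σ := σ) γ + (n : MvPolynomial σ ℝ) + 1) = C (2 * (γ + n + 1)) := by simp [C_two]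
      have hb : (2 * C (σ := σ) γ + (n : MvPolynomial σ ℝ)) = C (2 * γ + n) := by simp [C_two]
      rw [ha, hb, hc] at hD
      simp only [C_mul', map_sub, Derivation.map_smul, Derivation.leibniz, hl,
        dirDeriv_normSqPoly, smul_eq_mul] at hD
      simp only [smul_eq_C_mul] at hD
      rw [← ha, ← hb, ← hc, ih1] at hD
      push_cast
      linear_combination hD - (2 * C (σ := σ) γ + n) * ih2
    · rw [ih1]
      push_cast
      linear_combination h

theorem laplacian_zonal (γ : ℝ) (hγ : γ = ((Fintype.card σ : ℝ) - 2) / 2) (y : σ → ℝ)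
    (hy : ∑ i, y i ^ 2 = 1) (n : ℕ) : laplacian (zonal γ y n) = 0 := by
  induction n using Nat.twoStepInduction with
  | zero => simp [zonal, laplacian]
  | one => simp [zonal, laplacian, pderiv_linForm]
  | more n h0 h1 =>
    rw [zonal, laplacian_sub, laplacian_C_mul, laplacian_C_mul, laplacian_linForm_mul,
      laplacian_normSqPoly_mul (isHomogeneous_zonal γ y n), h0, h1, (dirDeriv_zonal γ y hy n).1]
    have hd : (Fintype.card σ : MvPolynomial σ ℝ) = C (2 * γ + 2) := by
      rw [show 2 * γ + 2 = Fintype.card σ by rw [hγ]; ring, map_natCast]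
    have hn : (n : MvPolynomial σ ℝ) = C (n : ℝ) := by simp
    have h2 : (2 : MvPolynomial σ ℝ) = C 2 := C_two.symm
    have h4 : (4 : MvPolynomial σ ℝ) = C 4 := (map_ofNat C 4).symm
    rw [hd, hn, h4, h2]
    have key : C (2 * (γ + ((n : ℝ) + 1)) / (((n : ℝ) + 1) + 1)) * (C 2 * (C 2 * C (σ := σ) γ + C (n : ℝ)))
        = (C ((2 * γ + ((n : ℝ) + 1) - 1) / (((n : ℝ) + 1) + 1)) *
          (C 4 * C (n : ℝ) + C 2 * C (2 * γ + 2)) : MvPolynomial σ ℝ) := by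
      simp only [← C_mul, ← C_add]
      congr 1
      field_simp
      ring
    linear_combination (zonal γ y n) * key

theorem exists_zonal_eq (γ : ℝ) (hγ : 0 < γ) (n : ℕ) :
    ∃ c : ℝ, 0 < c ∧ ∀ y : σ → ℝ, ∃ W,
      zonal γ y n = C c * linForm y ^ n + normSqPoly σ * W := by
  induction n using Nat.twoStepInduction with
  | zero => exact ⟨1, one_pos, fun y => ⟨0, by simp [zonal]⟩⟩
  | one => exact ⟨2 * γ, by positivity, fun y => ⟨0, by simp [zonal]⟩⟩
  | more n _ h1 =>
    obtain ⟨c, hc, h⟩ := h1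
    refine ⟨2 * (γ + ((n : ℝ) + 1)) / (((n : ℝ) + 1) + 1) * c, by positivity, fun y => ?_⟩
    obtain ⟨W, hW⟩ := h y
    refine ⟨C (2 * (γ + ((n : ℝ) + 1)) / (((n : ℝ) + 1) + 1)) * (linForm y * W) -
      C ((2 * γ + ((n : ℝ) + 1) - 1) / (((n : ℝ) + 1) + 1)) * zonal γ y n, ?_⟩
    rw [zonal, hW, C_mul]
    ring

theorem exists_fischer_zonal_eq (γ : ℝ) (hγ : γ = ((Fintype.card σ : ℝ) - 2) / 2) (hγ0 : 0 < γ)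
    (n : ℕ) : ∃ c : ℝ, 0 < c ∧ ∀ x y : σ → ℝ, ∑ i, x i ^ 2 = 1 → ∑ i, y i ^ 2 = 1 →
      fischer (zonal γ x n) (zonal γ y n) = c * gegenbauer γ n (∑ i, y i * x i) := by
  obtain ⟨c, hc, h⟩ := exists_zonal_eq (σ := σ) γ hγ0 n
  refine ⟨c * n.factorial, by positivity, fun x y hx hy => ?_⟩
  obtain ⟨W, hW⟩ := h x
  rw [hW, map_add, LinearMap.add_apply, fischer_C_mul, fischer_normSqPoly_mul,
    laplacian_zonal γ hγ y hy, map_zero, add_zero,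
    fischer_linForm_pow x (isHomogeneous_zonal γ y n), eval_zonal γ x y hx, mul_assoc]

end Fischer

theorem posSemidef_gegenbauer_gram {d : ℕ} (hd : 3 ≤ d) {γ : ℝ} (hγ : γ = ((d : ℝ) - 2) / 2)
    (k : ℕ) {m : ℕ} (x : Fin m → EuclideanSpace ℝ (Fin d)) (hx : ∀ i, ‖x i‖ = 1) :
    (Matrix.of fun i j => gegenbauer γ k ⟪x i, x j⟫).PosSemidef := by
  have hd' : (3 : ℝ) ≤ d := by exact_mod_cast hd
  obtain ⟨c, hc, h⟩ := exists_fischer_zonal_eq (σ := Fin d) γ (by simpa using hγ)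
    (by rw [hγ]; linarith) k
  have hx' (i : Fin m) : ∑ l, x i l ^ 2 = 1 := by
    rw [← EuclideanSpace.real_norm_sq_eq, hx, one_pow]
  have hG (i j : Fin m) :
      c * gegenbauer γ k ⟪x i, x j⟫ = fischer (zonal γ (x i) k) (zonal γ (x j) k) := by
    rw [h _ _ (hx' i) (hx' j), PiLp.inner_apply]
    simp
  refine .of_dotProduct_mulVec_nonneg ?_ fun a => ?_
  · ext i j
    simp [real_inner_comm]
  · refine nonneg_of_mul_nonneg_right ?_ hc
    suffices h : c * (star a ⬝ᵥ (Matrix.of fun i j => gegenbauer γ k ⟪x i, x j⟫) *ᵥ a) =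
        fischer (∑ i, a i • zonal γ (x i) k) (∑ i, a i • zonal γ (x i) k) from
      h ▸ fischer_self_nonneg _
    simp only [dotProduct, mulVec, Matrix.of_apply, map_sum, LinearMap.sum_apply, map_smul,
      LinearMap.smul_apply, smul_eq_mul, ← hG, Finset.mul_sum, star_trivial]
    rw [Finset.sum_comm]
    refine Finset.sum_congr rfl fun i _ => Finset.sum_congr rfl fun j _ => ?_
    ring

/-- For `d ≥ 3` and `γ = (d−2)/2`, each Gegenbauer polynomial `G_k^γ` applied to the Gram
matrix of points on the unit sphere `S^{d-1}` gives a positive semidefinite matrix, and hence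
so does any finite nonnegative combination `Σ_{k=0}^N α_k G_k^γ`. -/
theorem gegenbauer_gram_posSemidef
    (d : ℕ) (hd : 3 ≤ d) (γ : ℝ) (hγ : γ = ((d : ℝ) - 2) / 2) :
    (∀ (k m : ℕ) (x : Fin m → EuclideanSpace ℝ (Fin d)), (∀ i, ‖x i‖ = 1) →
        (Matrix.of fun i j => gegenbauer γ k ⟪x i, x j⟫).PosSemidef) ∧
    ∀ (N m : ℕ) (α : ℕ → ℝ), (∀ k, 0 ≤ α k) →
      ∀ x : Fin m → EuclideanSpace ℝ (Fin d), (∀ i, ‖x i‖ = 1) →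
        (Matrix.of fun i j =>
          ∑ k ∈ Finset.range (N + 1), α k * gegenbauer γ k ⟪x i, x j⟫).PosSemidef := by
  refine ⟨fun k m x hx => posSemidef_gegenbauer_gram hd hγ k x hx, fun N m α hα x hx => ?_⟩
  have h := posSemidef_sum (Finset.range (N + 1)) fun k _ =>
    (posSemidef_gegenbauer_gram hd hγ k x hx).smul (hα k)
  convert h using 1
  ext i j
  simp [Matrix.sum_apply]
end
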